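/- arXiv:2002.05958 — 11 statements merged into one kernel-verified Lean document; each statement's English description precedes it below -/
import Mathlib

section
/- Soundness of PCL with respect to neighbourhood semantics: for every formula F of conditional logic, if F is derivable in the Hilbert system 𝒜_PCL, then F is valid in the class of all neighbourhood models. -/
/-- Formulas of conditional logic. -/
inductive Formula : Type
  | atom : ℕ → Formula
  | bot : Formula
  | and : Formula → Formula → Formula
  | or : Formula → Formula → Formula
  | imp : Formula → Formula → Formula
  | cond : Formula → Formula → Formula

namespace Formula

/-- ¬A abbreviates A → ⊥. -/
def neg (A : Formula) : Formula := A.imp Formula.bot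

/-- ⊤ abbreviates ⊥ → ⊥. -/
def top : Formula := Formula.bot.imp Formula.bot

/-- A ↔ B abbreviates (A → B) ∧ (B → A). -/
def biimp (A B : Formula) : Formula := (A.imp B).and (B.imp A)

/-- Boolean evaluation of a formula, where atoms are evaluated via `v` and
conditional subformulas are treated as atoms evaluated via `w`. -/
def beval (v : ℕ → Bool) (w : Formula → Formula → Bool) : Formula → Bool
  | atom p => v p
  | bot => false
  | and A B => beval v w A && beval v w B
  | or A B => beval v w A || beval v w B
  | imp A B => !(beval v w A) || beval v w B
  | cond A B => w A B

/-- Classical propositional tautology (conditional subformulas treated as atoms). -/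
def Tautology (F : Formula) : Prop := ∀ v w, beval v w F = true

end Formula

open Formula

/-- Hilbert-style derivability: classical tautologies, modus ponens,
(RCEA), (RCK), (ID), (R-And), (CM), (OR), plus extra axioms from `Ax`. -/
inductive Deriv (Ax : Set Formula) : Formula → Prop
  | taut {F : Formula} : Tautology F → Deriv Ax F
  | extra {F : Formula} : F ∈ Ax → Deriv Ax F
  | mp {A B : Formula} : Deriv Ax (A.imp B) → Deriv Ax A → Deriv Ax B
  | rcea {A B C : Formula} : Deriv Ax (A.biimp B) →
      Deriv Ax ((A.cond C).biimp (B.cond C))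
  | rck {A B C : Formula} : Deriv Ax (A.imp B) → Deriv Ax ((C.cond A).imp (C.cond B))
  | id {A : Formula} : Deriv Ax (A.cond A)
  | rAnd {A B C : Formula} : Deriv Ax (((A.cond B).and (A.cond C)).imp (A.cond (B.and C)))
  | cm {A B C : Formula} : Deriv Ax (((A.cond B).and (A.cond C)).imp ((A.and B).cond C))
  | or {A B C : Formula} : Deriv Ax (((A.cond C).and (B.cond C)).imp ((A.or B).cond C))

/-- Derivability in the basic preferential conditional logic PCL. -/
def PCL : Formula → Prop := Deriv ∅

/-- Forcing of a formula at a world, for raw neighbourhood data. -/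
def Force {W : Type} (N : W → Set (Set W)) (val : ℕ → Set W) : Formula → W → Prop
  | Formula.atom p, x => x ∈ val p
  | Formula.bot, _ => False
  | Formula.and A B, x => Force N val A x ∧ Force N val B x
  | Formula.or A B, x => Force N val A x ∨ Force N val B x
  | Formula.imp A B, x => Force N val A x → Force N val B x
  | Formula.cond A B, x => ∀ α ∈ N x, (∃ y ∈ α, Force N val A y) →
      ∃ β ∈ N x, β ⊆ α ∧ (∃ y ∈ β, Force N val A y) ∧
        ∀ y ∈ β, (Force N val A y → Force N val B y)

/-- A neighbourhood model. -/
structure NbhdModel where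
  W : Type
  wNonempty : Nonempty W
  N : W → Set (Set W)
  val : ℕ → Set W
  nbhdNonempty : ∀ x : W, ∀ α ∈ N x, α.Nonempty

/-- Forcing in a neighbourhood model. -/
def NbhdModel.force (M : NbhdModel) : Formula → M.W → Prop := Force M.N M.val

/-- Validity in the class of all neighbourhood models. -/
def ValidAll (F : Formula) : Prop := ∀ (M : NbhdModel) (x : M.W), M.force F x

/-- Total reflexivity. -/
def NbhdModel.TotallyReflexive (M : NbhdModel) : Prop :=
  ∀ x : M.W, ∃ α ∈ M.N x, x ∈ α

/-- Weak centering. -/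
def NbhdModel.WeaklyCentered (M : NbhdModel) : Prop :=
  ∀ x : M.W, ∀ α ∈ M.N x, x ∈ α

/-- Centering. -/
def NbhdModel.Centered (M : NbhdModel) : Prop :=
  (∀ x : M.W, ∀ α ∈ M.N x, x ∈ α) ∧ ∀ x : M.W, {x} ∈ M.N x

/-- Uniformity. -/
def NbhdModel.Uniform (M : NbhdModel) : Prop :=
  ∀ x y : M.W, (∃ α ∈ M.N x, y ∈ α) → ⋃₀ M.N x = ⋃₀ M.N y

/-- Absoluteness. -/
def NbhdModel.Absolute (M : NbhdModel) : Prop :=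
  ∀ x y : M.W, ∀ α ∈ M.N x, y ∈ α → M.N x = M.N y

/-- Conjunction of a list of formulas. -/
def conj : List Formula → Formula
  | [] => Formula.top
  | A :: l => A.and (conj l)

/-- A set of formulas is inconsistent if some nonempty finite list of its members
has a PCL-provably contradictory conjunction. -/
def Inconsistent (S : Set Formula) : Prop :=
  ∃ L : List Formula, L ≠ [] ∧ (∀ B ∈ L, B ∈ S) ∧ PCL ((conj L).imp Formula.bot)

def Consistent (S : Set Formula) : Prop := ¬ Inconsistent S

/-- Maximal consistent set. -/
def MaxConsistent (S : Set Formula) : Prop :=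
  Consistent S ∧ ∀ A ∉ S, Inconsistent (insert A S)

/-- Set of conditional consequences X^B = {C : B > C ∈ X}. -/
def condCons (X : Set Formula) (B : Formula) : Set Formula := {C | B.cond C ∈ X}

/-- A ≤_X B iff (A ∨ B) > A ∈ X. -/
def cleq (X : Set Formula) (A B : Formula) : Prop := (A.or B).cond A ∈ X

/-- Worlds of the canonical model: pairs (X, A) with X maximal consistent, A ∈ X. -/
def CanonWorld : Type :=
  {p : Set Formula × Formula // MaxConsistent p.1 ∧ p.2 ∈ p.1}

/-- Canonical neighbourhood α^X_{(Y,B)}. -/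
def sphere (X : Set Formula) (Y : CanonWorld) : Set CanonWorld :=
  {Z | condCons X Z.val.2 ⊆ Z.val.1 ∧ cleq X Z.val.2 Y.val.2 ∧ Y.val.2 ∉ Z.val.1}
    ∪ {Y}

/-- Canonical neighbourhood function 𝒩(X,A). -/
def canonN (x : CanonWorld) : Set (Set CanonWorld) :=
  {α | ∃ Y : CanonWorld, condCons x.val.1 Y.val.2 ⊆ Y.val.1 ∧ α = sphere x.val.1 Y}

/-- Canonical valuation. -/
def canonVal (p : ℕ) : Set CanonWorld := {w | Formula.atom p ∈ w.val.1}

/-- Axiom (N). -/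
def axN : Formula := (Formula.top.cond Formula.bot).neg
/-- Axiom schema (T). -/
def axT : Set Formula := {F | ∃ A : Formula, F = A.imp (A.cond Formula.bot).neg}
/-- Axiom schema (W). -/
def axW : Set Formula := {F | ∃ A B : Formula, F = (A.cond B).imp (A.imp B)}
/-- Axiom schema (C). -/
def axC : Set Formula := {F | ∃ A B : Formula, F = (A.and B).imp (A.cond B)}
/-- Axiom schema (U1). -/
def axU1 : Set Formula :=
  {F | ∃ A : Formula,
    F = (A.neg.cond Formula.bot).imp ((A.neg.cond Formula.bot).neg.cond Formula.bot)}
/-- Axiom schema (U2). -/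
def axU2 : Set Formula :=
  {F | ∃ A : Formula,
    F = (A.cond Formula.bot).neg.imp ((A.cond Formula.bot).cond Formula.bot)}

theorem force_beval {W : Type} (N : W → Set (Set W)) (val : ℕ → Set W) (x : W)
    (v : ℕ → Bool) (w : Formula → Formula → Bool)
    (hv : ∀ p, v p = true ↔ x ∈ val p)
    (hw : ∀ A B, w A B = true ↔ Force N val (A.cond B) x) (F : Formula) :
    beval v w F = true ↔ Force N val F x := by
  induction F with
  | atom p => exact hv p
  | bot => simp [beval, Force]
  | and A B ihA ihB => simp [beval, Force, ihA, ihB]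
  | or A B ihA ihB => simp [beval, Force, ihA, ihB]
  | imp A B ihA ihB =>
    simp only [beval, Force, ← ihA, ← ihB]
    cases beval v w A <;> simp
  | cond A B => exact hw A B

theorem deriv_sound {W : Type} (N : W → Set (Set W)) (val : ℕ → Set W) (F : Formula)
    (h : Deriv ∅ F) : ∀ x, Force N val F x := by
  induction h with
  | taut h =>
    intro x
    classical
    exact (force_beval N val x (fun p => decide (x ∈ val p))
      (fun A B => decide (Force N val (A.cond B) x)) (by simp) (by simp) _).1 (h _ _)
  | extra h => exact absurd h (Set.notMem_empty _)
  | mp _ _ ih1 ih2 => intro x; exact ih1 x (ih2 x)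
  | @rcea A B C _ ih =>
    intro x
    have e : ∀ y, Force N val A y ↔ Force N val B y := fun y => ⟨(ih y).1, (ih y).2⟩
    simp only [biimp, Force, e]
    exact ⟨fun h => h, fun h => h⟩
  | rck _ ih =>
    intro x h α hα hA
    obtain ⟨β, hβ, hs, hy, hall⟩ := h α hα hA
    exact ⟨β, hβ, hs, hy, fun y hy hc => ih y (hall y hy hc)⟩
  | id =>
    intro x α hα hA
    exact ⟨α, hα, subset_rfl, hA, fun _ _ h => h⟩
  | rAnd =>
    rintro x ⟨h1, h2⟩ α hα hA
    obtain ⟨β, hβ, hs, hy, hall⟩ := h1 α hα hA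
    obtain ⟨γ, hγ, hs', hy', hall'⟩ := h2 β hβ hy
    exact ⟨γ, hγ, hs'.trans hs, hy', fun y hm ha => ⟨hall y (hs' hm) ha, hall' y hm ha⟩⟩
  | cm =>
    rintro x ⟨h1, h2⟩ α hα ⟨y, hyα, hyA, -⟩
    obtain ⟨β, hβ, hs, hy, hall⟩ := h1 α hα ⟨y, hyα, hyA⟩
    obtain ⟨γ, hγ, hs', ⟨z, hz, hzA⟩, hall'⟩ := h2 β hβ hy
    exact ⟨γ, hγ, hs'.trans hs, ⟨z, hz, hzA, hall z (hs' hz) hzA⟩,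
      fun y hm ha => hall' y hm ha.1⟩
  | @or A B C =>
    have key : ∀ (A B : Formula) (x : W), Force N val (A.cond C) x → Force N val (B.cond C) x →
        ∀ α ∈ N x, (∃ y ∈ α, Force N val A y) →
        ∃ β ∈ N x, β ⊆ α ∧ (∃ y ∈ β, Force N val A y ∨ Force N val B y) ∧
          ∀ y ∈ β, (Force N val A y ∨ Force N val B y → Force N val C y) := by
      intro A B x h1 h2 α hα hA
      obtain ⟨β, hβ, hs, ⟨z, hz, hzA⟩, hall⟩ := h1 α hα hA
      by_cases hB : ∃ y ∈ β, Force N val B y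
      · obtain ⟨γ, hγ, hs', ⟨u, hu, huB⟩, hall'⟩ := h2 β hβ hB
        exact ⟨γ, hγ, hs'.trans hs, ⟨u, hu, Or.inr huB⟩,
          fun y hm ha => ha.elim (hall y (hs' hm)) (hall' y hm)⟩
      · exact ⟨β, hβ, hs, ⟨z, hz, Or.inl hzA⟩,
          fun y hm ha => ha.elim (hall y hm) (fun hb => absurd ⟨y, hm, hb⟩ hB)⟩
    rintro x ⟨h1, h2⟩ α hα ⟨y, hyα, hA | hB⟩
    · exact key A B x h1 h2 α hα ⟨y, hyα, hA⟩
    · obtain ⟨β, hβ, hs, ⟨z, hz, hzA⟩, hall⟩ := key B A x h2 h1 α hα ⟨y, hyα, hB⟩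
      exact ⟨β, hβ, hs, ⟨z, hz, hzA.symm⟩, fun y hm ha => hall y hm (Or.symm ha)⟩

/-- Soundness of PCL w.r.t. neighbourhood semantics. -/
theorem pcl_soundness (F : Formula) (h : PCL F) : ValidAll F := by
  intro M x
  exact deriv_sound M.N M.val F h x
end

section
/- For all formulas A, B, C of conditional logic, the axiom (CM), i.e. the formula ((A>B) ∧ (A>C)) → ((A∧B) > C), is valid in the class of all neighbourhood models. -/
open Formula

/-- Axiom (CM) is valid in the class of all neighbourhood models. -/
theorem cm_valid (A B C : Formula) :
    ValidAll (((A.cond B).and (A.cond C)).imp ((A.and B).cond C)) := by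
  rintro M x ⟨hB, hC⟩ α hα ⟨y, hy, hyA, _⟩
  obtain ⟨β, hβ, hβα, hβA, hβB⟩ := hB α hα ⟨y, hy, hyA⟩
  obtain ⟨γ, hγ, hγβ, ⟨z, hz, hzA⟩, hγC⟩ := hC β hβ hβA
  exact ⟨γ, hγ, hγβ.trans hβα, ⟨z, hz, hzA, hβB z (hγβ hz) hzA⟩,
    fun w hw hwAB => hγC w hw hwAB.1⟩
end

section
/- For every formula A of conditional logic, the axiom (U1), i.e. the formula (¬A > ⊥) → ((¬(¬A > ⊥)) > ⊥), is valid in the class of all uniform neighbourhood models. -/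
open Formula

/-- Axiom (U1) is valid in the class of all uniform neighbourhood models. -/
theorem u1_valid (A : Formula) :
    ∀ M : NbhdModel, M.Uniform → ∀ x : M.W,
      M.force ((A.neg.cond Formula.bot).imp
        ((A.neg.cond Formula.bot).neg.cond Formula.bot)) x := by
  intro M hU x h α hα ⟨y, hy, hny⟩
  exfalso
  apply hny
  intro γ hγ ⟨z, hz, hnz⟩
  exfalso
  have hmem : z ∈ ⋃₀ M.N x := by
    rw [hU x y ⟨α, hα, hy⟩]
    exact ⟨γ, hγ, hz⟩
  obtain ⟨δ, hδ, hzδ⟩ := hmem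
  obtain ⟨β, _, _, ⟨w, hw, hnw⟩, hall⟩ := h δ hδ ⟨z, hzδ, hnz⟩
  exact hall w hw hnw
end

section
/- Derivability of (CSO) in PCL: for all formulas A, B, C of conditional logic, ⊢_PCL ((A>B) ∧ (B>A)) → ((A>C) → (B>C)). -/
open Formula

/-- (CSO) is derivable in PCL. -/
theorem cso_derivable (A B C : Formula) :
    PCL (((A.cond B).and (B.cond A)).imp ((A.cond C).imp (B.cond C))) := by
  have h1 : PCL (((A.cond B).and (A.cond C)).imp ((A.and B).cond C)) := Deriv.cm
  have h2 : PCL (((A.and B).cond C).imp ((A.and B).cond (A.imp C))) :=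
    Deriv.rck (Deriv.taut (by
      intro v w
      simp only [beval]
      cases beval v w A <;> cases beval v w C <;> rfl))
  have h3 : PCL ((B.and A.neg).cond (B.and A.neg)) := Deriv.id
  have h4 : PCL (((B.and A.neg).cond (B.and A.neg)).imp ((B.and A.neg).cond (A.imp C))) :=
    Deriv.rck (Deriv.taut (by
      intro v w
      simp only [beval, neg]
      cases beval v w A <;> cases beval v w B <;> cases beval v w C <;> rfl))
  have h5 : PCL ((((A.and B).cond (A.imp C)).and ((B.and A.neg).cond (A.imp C))).imp
      (((A.and B).or (B.and A.neg)).cond (A.imp C))) := Deriv.or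
  have h6 : PCL ((((A.and B).or (B.and A.neg)).cond (A.imp C)).biimp (B.cond (A.imp C))) :=
    Deriv.rcea (Deriv.taut (by
      intro v w
      simp only [beval, neg, biimp]
      cases beval v w A <;> cases beval v w B <;> rfl))
  have h7 : PCL (((B.cond A).and (B.cond (A.imp C))).imp (B.cond (A.and (A.imp C)))) :=
    Deriv.rAnd
  have h8 : PCL ((B.cond (A.and (A.imp C))).imp (B.cond C)) :=
    Deriv.rck (Deriv.taut (by
      intro v w
      simp only [beval]
      cases beval v w A <;> cases beval v w C <;> rfl))
  refine Deriv.mp (Deriv.mp (Deriv.mp (Deriv.mp (Deriv.mp (Deriv.mp (Deriv.mp (Deriv.mp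
    (Deriv.taut ?_) h1) h2) h3) h4) h5) h6) h7) h8
  intro v w
  simp only [beval, biimp]
  grind
end

section
/- Derivability of (MOD) in PCL: for all formulas A, B of conditional logic, ⊢_PCL (A > ⊥) → (B > ¬A). -/
open Formula

/-- (MOD) is derivable in PCL. -/
theorem mod_derivable (A B : Formula) :
    PCL ((A.cond Formula.bot).imp (B.cond A.neg)) := by
  have t {F : Formula} : Tautology F → Deriv ∅ F := Deriv.taut
  have h1 : Deriv ∅ ((A.cond bot).imp (A.cond B)) :=
    Deriv.rck (t (by intro v w; simp [beval]))
  have h2 : Deriv ∅ (((A.cond B).and (A.cond bot)).imp ((A.and B).cond bot)) := Deriv.cm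
  have h3 : Deriv ∅ (((A.and B).cond bot).imp ((A.and B).cond A.neg)) :=
    Deriv.rck (t (by intro v w; simp [beval]))
  have h4 : Deriv ∅ ((B.and A.neg).cond A.neg) :=
    Deriv.mp (Deriv.rck (t (by
      intro v w
      simp only [beval, neg]
      cases beval v w A <;> cases beval v w B <;> rfl))) Deriv.id
  have h5 : Deriv ∅ ((((A.and B).cond A.neg).and ((B.and A.neg).cond A.neg)).imp
      (((A.and B).or (B.and A.neg)).cond A.neg)) := Deriv.or
  have h6 : Deriv ∅ ((((A.and B).or (B.and A.neg)).cond A.neg).biimp (B.cond A.neg)) :=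
    Deriv.rcea (t (by
      intro v w
      simp only [beval, neg, biimp]
      cases beval v w A <;> cases beval v w B <;> rfl))
  refine Deriv.mp (Deriv.mp (Deriv.mp (Deriv.mp (Deriv.mp (Deriv.mp (t ?_) h1) h2) h3) h4) h5) h6
  intro v w
  simp only [beval, biimp]
  grind
end

section
/- For all formulas A, B, C of conditional logic, ⊢_PCL (((A∨B) > A) ∧ ((B∨C) > B)) → ((A∨C) > A). -/
open Formula

theorem pcl_taut_mp {P Q : Formula} (h : Deriv ∅ P) (t : Tautology (P.imp Q)) : Deriv ∅ Q :=
  Deriv.mp (Deriv.taut t) h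

theorem pcl_trans {G P Q : Formula} (h : Deriv ∅ (G.imp P)) (k : Deriv ∅ (P.imp Q)) :
    Deriv ∅ (G.imp Q) := by
  refine Deriv.mp (pcl_taut_mp h ?_) k
  intro v w
  simp only [beval]
  cases beval v w G <;> cases beval v w P <;> cases beval v w Q <;> rfl

theorem pcl_pair {G P Q : Formula} (h : Deriv ∅ (G.imp P)) (k : Deriv ∅ (G.imp Q)) :
    Deriv ∅ (G.imp (P.and Q)) := by
  refine Deriv.mp (pcl_taut_mp h ?_) k
  intro v w
  simp only [beval]
  cases beval v w G <;> cases beval v w P <;> cases beval v w Q <;> rfl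

theorem pcl_weak {G P : Formula} (h : Deriv ∅ P) : Deriv ∅ (G.imp P) := by
  refine pcl_taut_mp h ?_
  intro v w
  simp only [beval]
  cases beval v w G <;> cases beval v w P <;> rfl

/-- Right weakening in context. -/
theorem pcl_rw {G P Q R : Formula} (h : Deriv ∅ (G.imp (P.cond Q))) (t : Tautology (Q.imp R)) :
    Deriv ∅ (G.imp (P.cond R)) :=
  pcl_trans h (Deriv.rck (Deriv.taut t))

/-- Left logical equivalence in context. -/
theorem pcl_lle {G P Q R : Formula} (h : Deriv ∅ (G.imp (P.cond R))) (t : Tautology (P.biimp Q)) :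
    Deriv ∅ (G.imp (Q.cond R)) := by
  refine pcl_trans h (pcl_taut_mp (Deriv.rcea (C := R) (Deriv.taut t)) ?_)
  intro v w
  simp only [beval, biimp]
  cases w P R <;> cases w Q R <;> rfl

/-- ((A∨B)>A) ∧ ((B∨C)>B) → ((A∨C)>A) is derivable in PCL. -/
theorem disj_chain_derivable (A B C : Formula) :
    PCL ((((A.or B).cond A).and ((B.or C).cond B)).imp ((A.or C).cond A)) := by
  unfold PCL
  generalize hG : ((A.or B).cond A).and ((B.or C).cond B) = G
  have h1 : Deriv ∅ (G.imp ((A.or B).cond A)) := by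
    subst hG
    refine Deriv.taut ?_
    intro v w
    simp only [beval]
    cases w (A.or B) A <;> cases w (B.or C) B <;> rfl
  have h2 : Deriv ∅ (G.imp ((B.or C).cond B)) := by
    subst hG
    refine Deriv.taut ?_
    intro v w
    simp only [beval]
    cases w (A.or B) A <;> cases w (B.or C) B <;> rfl
  -- `D > (A ∨ B)` where `D = A ∨ (B ∨ C)`
  have h3 : Deriv ∅ (G.imp ((A.or (B.or C)).cond (A.or B))) :=
    pcl_trans (pcl_pair
      (pcl_rw (R := A.or B) (pcl_weak (Deriv.id (A := A)))
        (by intro v w; simp only [beval, biimp, neg]; cases beval v w A <;> cases beval v w B <;> cases beval v w C <;> rfl))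
      (pcl_rw (R := A.or B) h2
        (by intro v w; simp only [beval, biimp, neg]; cases beval v w A <;> cases beval v w B <;> cases beval v w C <;> rfl))) Deriv.or
  -- `D > ((A ∨ B) → A)`
  have h4 : Deriv ∅ (G.imp ((A.or (B.or C)).cond ((A.or B).imp A))) :=
    pcl_lle (P := (A.or B).or (C.and (A.or B).neg)) (pcl_trans (pcl_pair
      (pcl_rw (R := (A.or B).imp A) h1
        (by intro v w; simp only [beval, biimp, neg]; cases beval v w A <;> cases beval v w B <;> cases beval v w C <;> rfl))
      (pcl_rw (R := (A.or B).imp A) (pcl_weak (Deriv.id (A := C.and (A.or B).neg)))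
        (by intro v w; simp only [beval, biimp, neg]; cases beval v w A <;> cases beval v w B <;> cases beval v w C <;> rfl))) Deriv.or)
      (by intro v w; simp only [beval, biimp, neg]; cases beval v w A <;> cases beval v w B <;> cases beval v w C <;> rfl)
  have h5 : Deriv ∅ (G.imp ((A.or (B.or C)).cond A)) :=
    pcl_rw (pcl_trans (pcl_pair h3 h4) Deriv.rAnd)
      (by intro v w; simp only [beval, biimp, neg]; cases beval v w A <;> cases beval v w B <;> cases beval v w C <;> rfl)
  have h6 : Deriv ∅ (G.imp ((A.or (B.or C)).cond (A.or C))) :=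
    pcl_rw h5
      (by intro v w; simp only [beval, biimp, neg]; cases beval v w A <;> cases beval v w B <;> cases beval v w C <;> rfl)
  exact pcl_lle (pcl_trans (pcl_pair h6 h5) Deriv.cm)
    (by intro v w; simp only [beval, biimp, neg]; cases beval v w A <;> cases beval v w B <;> cases beval v w C <;> rfl)
end

section
/- For every maximal consistent set X and all formulas B, C: B > C ∈ X if and only if for every maximal consistent set Y, X^B ⊆ Y implies C ∈ Y. -/
open Formula

theorem PCL.sound {F : Formula} (h : PCL F) :
    beval (fun _ => true) (fun _ _ => true) F = true := by
  induction h with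
  | taut h => exact h _ _
  | extra h => exact absurd h (Set.notMem_empty _)
  | mp _ _ ih1 ih2 => simpa [beval, ih2] using ih1
  | rcea _ _ => simp [beval, biimp]
  | rck _ _ => simp [beval]
  | id => simp [beval]
  | rAnd => simp [beval]
  | cm => simp [beval]
  | or => simp [beval]

theorem not_PCL_bot : ¬ PCL Formula.bot := fun h => by
  simpa [beval] using h.sound

theorem PCL.mp {A B : Formula} (h : PCL (A.imp B)) (h' : PCL A) : PCL B := Deriv.mp h h'

theorem PCL.trans {A B C : Formula} (h : PCL (A.imp B)) (h' : PCL (B.imp C)) :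
    PCL (A.imp C) := by
  have t : PCL ((A.imp B).imp ((B.imp C).imp (A.imp C))) :=
    Deriv.taut (by
      intro v w; simp only [beval]
      cases beval v w A <;> cases beval v w B <;> cases beval v w C <;> rfl)
  exact (t.mp h).mp h'

theorem beval_conj (v : ℕ → Bool) (w : Formula → Formula → Bool) (L : List Formula) :
    beval v w (conj L) = true ↔ ∀ A ∈ L, beval v w A = true := by
  induction L with
  | nil => simp [conj, top, beval]
  | cons A L ih => simp [conj, beval, ih]

theorem Consistent.not_pcl {S : Set Formula} (hS : Consistent S) {L : List Formula}
    (hL : ∀ B ∈ L, B ∈ S) : ¬ PCL ((conj L).imp Formula.bot) := by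
  intro h
  by_cases hn : L = []
  · subst hn
    exact not_PCL_bot (h.mp (Deriv.taut (by intro v w; simp [conj, top, beval])))
  · exact hS ⟨L, hn, hL, h⟩

/-- Deduction form of inconsistency of an extended set. -/
theorem Inconsistent.insert {S : Set Formula} {A : Formula} (h : Inconsistent (insert A S)) :
    ∃ L : List Formula, (∀ B ∈ L, B ∈ S) ∧ PCL ((conj L).imp A.neg) := by
  classical
  obtain ⟨L, -, hL, hp⟩ := h
  refine ⟨L.filter (fun B => decide (B ∈ S)), by simp, ?_⟩
  have t : PCL (((conj L).imp Formula.bot).imp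
      ((conj (L.filter (fun B => decide (B ∈ S)))).imp A.neg)) := by
    refine Deriv.taut ?_
    intro v w
    have key : beval v w (conj (L.filter (fun B => decide (B ∈ S)))) = true →
        beval v w A = true → beval v w (conj L) = true := by
      rw [beval_conj, beval_conj]
      intro h1 hA B hB
      rcases hL B hB with rfl | hs
      · exact hA
      · exact h1 B (by simp [hB, hs])
    simp only [beval, neg]
    revert key
    cases beval v w (conj (L.filter (fun B => decide (B ∈ S)))) <;> cases beval v w A <;>
      cases beval v w (conj L) <;> simp
  exact t.mp hp

theorem MaxConsistent.closed {X : Set Formula} (hX : MaxConsistent X) {L : List Formula}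
    {F : Formula} (hL : ∀ B ∈ L, B ∈ X) (h : PCL ((conj L).imp F)) : F ∈ X := by
  by_contra hF
  obtain ⟨L', hL', h'⟩ := (hX.2 F hF).insert
  refine hX.1.not_pcl (L := L ++ L') (fun B hB => ?_) ?_
  · rcases List.mem_append.1 hB with h | h
    · exact hL B h
    · exact hL' B h
  · have t : PCL (((conj L).imp F).imp (((conj L').imp F.neg).imp
        ((conj (L ++ L')).imp Formula.bot))) := by
      refine Deriv.taut ?_
      intro v w
      have k1 : beval v w (conj (L ++ L')) = true → beval v w (conj L) = true := by
        rw [beval_conj, beval_conj]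
        exact fun h B hB => h B (by simp [hB])
      have k2 : beval v w (conj (L ++ L')) = true → beval v w (conj L') = true := by
        rw [beval_conj, beval_conj]
        exact fun h B hB => h B (by simp [hB])
      simp only [beval, neg]
      revert k1 k2
      cases beval v w (conj (L ++ L')) <;> cases beval v w F <;>
        cases beval v w (conj L) <;> cases beval v w (conj L') <;> simp
    exact (t.mp h).mp h'

theorem MaxConsistent.mem_of_imp {X : Set Formula} (hX : MaxConsistent X) {A F : Formula}
    (hA : A ∈ X) (h : PCL (A.imp F)) : F ∈ X := by
  refine hX.closed (L := [A]) (by simpa using hA) (PCL.trans (Deriv.taut ?_) h)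
  intro v w
  simp only [beval, conj, top]
  cases beval v w A <;> rfl

theorem MaxConsistent.mem_of_pcl {X : Set Formula} (hX : MaxConsistent X) {F : Formula}
    (h : PCL F) : F ∈ X := by
  refine hX.closed (L := []) (by simp) (PCL.mp (Deriv.taut ?_) h)
  intro v w
  simp only [beval, conj, top]
  cases beval v w F <;> rfl

theorem MaxConsistent.and_mem {X : Set Formula} (hX : MaxConsistent X) {A B : Formula}
    (hA : A ∈ X) (hB : B ∈ X) : A.and B ∈ X := by
  refine hX.closed (L := [A, B]) (by simp [hA, hB]) (Deriv.taut ?_)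
  intro v w
  simp only [beval, conj, top]
  cases beval v w A <;> cases beval v w B <;> rfl

theorem MaxConsistent.cond_conj {X : Set Formula} (hX : MaxConsistent X) (B : Formula)
    (L : List Formula) (hL : ∀ A ∈ L, A ∈ condCons X B) : B.cond (conj L) ∈ X := by
  induction L with
  | nil =>
    refine hX.mem_of_imp (A := B.cond B) (hX.mem_of_pcl Deriv.id) (Deriv.rck (Deriv.taut ?_))
    intro v w
    simp [beval, conj, top]
  | cons A L ih =>
    exact hX.mem_of_imp (hX.and_mem (hL A (by simp)) (ih fun C hC => hL C (by simp [hC])))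
      Deriv.rAnd

theorem list_mem_chain {c : Set (Set Formula)} (hc : IsChain (· ⊆ ·) c) (hne : c.Nonempty)
    (L : List Formula) (hL : ∀ B ∈ L, B ∈ ⋃₀ c) : ∃ s ∈ c, ∀ B ∈ L, B ∈ s := by
  induction L with
  | nil => obtain ⟨s, hs⟩ := hne; exact ⟨s, hs, by simp⟩
  | cons A L ih =>
    obtain ⟨s, hs, h1⟩ := ih fun C hC => hL C (by simp [hC])
    obtain ⟨t, ht, h2⟩ := hL A (by simp)
    rcases hc.total hs ht with h | h
    · refine ⟨t, ht, fun B hB => ?_⟩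
      rcases List.mem_cons.1 hB with rfl | hB
      · exact h2
      · exact h (h1 B hB)
    · refine ⟨s, hs, fun B hB => ?_⟩
      rcases List.mem_cons.1 hB with rfl | hB
      · exact h h2
      · exact h1 B hB

theorem lindenbaum {S : Set Formula} (hS : Consistent S) :
    ∃ Y, MaxConsistent Y ∧ S ⊆ Y := by
  obtain ⟨Y, hSY, hY⟩ := zorn_subset_nonempty {T | Consistent T} (by
    intro c hc hch hne
    refine ⟨⋃₀ c, ?_, fun s hs => Set.subset_sUnion_of_mem hs⟩
    rintro ⟨L, hn, hL, hp⟩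
    obtain ⟨s, hs, h⟩ := list_mem_chain hch hne L hL
    exact hc hs ⟨L, hn, h, hp⟩) S hS
  refine ⟨Y, ⟨hY.prop, fun A hA => ?_⟩, hSY⟩
  by_contra hcon
  exact hA (hY.le_of_ge (y := insert A Y) hcon (Set.subset_insert A Y) (Set.mem_insert A Y))

/-- B > C ∈ X iff every maximal consistent Y ⊇ X^B contains C. -/
theorem cond_mem_iff (X : Set Formula) (hX : MaxConsistent X) (B C : Formula) :
    B.cond C ∈ X ↔
      ∀ Y : Set Formula, MaxConsistent Y → condCons X B ⊆ Y → C ∈ Y := by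
  refine ⟨fun h Y _ hs => hs h, fun h => ?_⟩
  by_contra hC
  have hcons : Consistent (insert C.neg (condCons X B)) := by
    intro hi
    obtain ⟨L, hL, hp⟩ := hi.insert
    refine hC (hX.mem_of_imp (hX.cond_conj B L hL) (Deriv.rck (PCL.trans hp (Deriv.taut ?_))))
    intro v w
    simp only [beval, neg]
    cases beval v w C <;> rfl
  obtain ⟨Y, hY, hsub⟩ := lindenbaum hcons
  have h1 : C ∈ Y := h Y hY fun A hA => hsub (Set.mem_insert_of_mem _ hA)
  have h2 : C.neg ∈ Y := hsub (Set.mem_insert _ _)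
  refine hY.1.not_pcl (L := [C, C.neg]) (by simp [h1, h2]) (Deriv.taut ?_)
  intro v w
  simp only [beval, conj, top, neg]
  cases beval v w C <;> rfl
end

section
/- Let X and Y be maximal consistent sets (relative to 𝒜_PCL) and A, B formulas. If A ≤_X B, X^A ⊆ Y, and B ∈ Y, then X^B ⊆ Y. -/
open Formula

theorem exists_split (X : Set Formula) (G : Formula) (L : List Formula)
    (hL : ∀ B ∈ L, B ∈ insert G X) :
    ∃ L' : List Formula, (∀ B ∈ L', B ∈ X) ∧
      ∀ v w, beval v w G = true → beval v w (conj L') = true → beval v w (conj L) = true := by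
  induction L with
  | nil => exact ⟨[], by simp, by intros; assumption⟩
  | cons D L ih =>
    obtain ⟨L', h1, h2⟩ := ih (fun B hB => hL B (List.mem_cons_of_mem _ hB))
    rcases hL D List.mem_cons_self with rfl | hD
    · refine ⟨L', h1, fun v w hG hc => ?_⟩
      simp [conj, beval, hG, h2 v w hG hc]
    · refine ⟨D :: L', ?_, fun v w hG hc => ?_⟩
      · intro B hB
        rcases List.mem_cons.1 hB with rfl | hB
        · exact hD
        · exact h1 B hB
      · simp only [conj, beval, Bool.and_eq_true] at hc ⊢
        exact ⟨hc.1, h2 v w hG hc.2⟩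

theorem mcs_closed {X : Set Formula} (hX : MaxConsistent X) {F1 F2 G : Formula}
    (h1 : F1 ∈ X) (h2 : F2 ∈ X) (h : PCL ((F1.and F2).imp G)) : G ∈ X := by
  by_contra hG
  obtain ⟨L, -, hL, hbot⟩ := hX.2 G hG
  obtain ⟨L', hL', hev⟩ := exists_split X G L hL
  refine hX.1 ⟨F1 :: F2 :: L', by simp, ?_, ?_⟩
  · intro B hB
    rcases List.mem_cons.1 hB with rfl | hB
    · exact h1
    rcases List.mem_cons.1 hB with rfl | hB
    · exact h2
    · exact hL' B hB
  · refine Deriv.mp (Deriv.mp (Deriv.taut ?_) h) hbot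
    intro v w
    have := hev v w
    simp only [conj, beval]
    generalize beval v w F1 = a at *
    generalize beval v w F2 = b at *
    generalize beval v w G = c at *
    generalize beval v w (conj L) = d at *
    generalize beval v w (conj L') = e at *
    revert a b c d e
    decide

theorem mcs_mono {X : Set Formula} (hX : MaxConsistent X) {F G : Formula}
    (h1 : F ∈ X) (h : PCL (F.imp G)) : G ∈ X := by
  refine mcs_closed hX h1 h1 (Deriv.mp (Deriv.taut ?_) h)
  intro v w
  simp only [beval]
  cases beval v w F <;> cases beval v w G <;> rfl

theorem mcs_thm {X : Set Formula} (hX : MaxConsistent X) {F G : Formula}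
    (h1 : F ∈ X) (h : PCL G) : G ∈ X := by
  refine mcs_mono hX h1 (Deriv.mp (Deriv.taut ?_) h)
  intro v w
  simp only [beval]
  cases beval v w F <;> cases beval v w G <;> rfl

theorem mcs_rcea {X : Set Formula} (hX : MaxConsistent X) {A B C : Formula}
    (h1 : A.cond C ∈ X) (h : Tautology (A.biimp B)) : B.cond C ∈ X := by
  refine mcs_mono hX h1 (Deriv.mp (Deriv.taut ?_) (Deriv.rcea (C := C) (Deriv.taut h)))
  intro v w
  simp only [beval, biimp]
  cases w A C <;> cases w B C <;> rfl

/-- If A ≤_X B, X^A ⊆ Y and B ∈ Y, then X^B ⊆ Y. -/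
theorem condCons_subset_of_cleq (X Y : Set Formula)
    (hX : MaxConsistent X) (hY : MaxConsistent Y) (A B : Formula)
    (h1 : cleq X A B) (h2 : condCons X A ⊆ Y) (h3 : B ∈ Y) :
    condCons X B ⊆ Y := by
  intro C hC
  have e1 : B.cond (B.imp C) ∈ X := by
    refine mcs_mono hX hC (Deriv.rck (Deriv.taut ?_))
    intro v w
    simp only [beval]
    cases beval v w B <;> cases beval v w C <;> rfl
  have e2 : (A.and B.neg).cond (B.imp C) ∈ X := by
    refine mcs_mono hX (mcs_thm hX hC (Deriv.id (A := A.and B.neg)))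
      (Deriv.rck (Deriv.taut ?_))
    intro v w
    simp only [beval, neg]
    cases beval v w A <;> cases beval v w B <;> cases beval v w C <;> rfl
  have e3 : (A.or B).cond (B.imp C) ∈ X := by
    refine mcs_rcea hX (mcs_closed hX e1 e2 Deriv.or) ?_
    intro v w
    simp only [beval, neg, biimp]
    cases beval v w A <;> cases beval v w B <;> rfl
  have e4 : A.cond (B.imp C) ∈ X := by
    refine mcs_rcea hX (mcs_closed hX h1 e3 Deriv.cm) ?_
    intro v w
    simp only [beval, biimp]
    cases beval v w A <;> cases beval v w B <;> rfl
  have e5 : B.imp C ∈ Y := h2 e4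
  refine mcs_closed hY h3 e5 (Deriv.taut ?_)
  intro v w
  simp only [beval]
  cases beval v w B <;> cases beval v w C <;> rfl
end

section
/- Let X and Y be maximal consistent sets (relative to 𝒜_PCL) and A, B, C formulas. If A ≤_X B, B ≤_X C, X^A ⊆ Y, and C ∈ Y, then X^B ⊆ Y. -/
open Formula

theorem pcl_mp2 {A B C : Formula} (h : Tautology (A.imp (B.imp C))) (h1 : PCL A) (h2 : PCL B) :
    PCL C := Deriv.mp (Deriv.mp (Deriv.taut h) h1) h2

theorem conj_append_taut (L M : List Formula) (v w) :
    beval v w (conj (L ++ M)) = (beval v w (conj L) && beval v w (conj M)) := by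
  induction L with
  | nil => simp [conj, beval, Formula.top]
  | cons a l ih => simp [conj, beval, ih, Bool.and_assoc]

/-- Any list from `insert A S` is implied by `A` together with a list from `S`. -/
theorem split_list (S : Set Formula) (A : Formula) (L : List Formula)
    (h : ∀ B ∈ L, B ∈ insert A S) :
    ∃ M : List Formula, (∀ B ∈ M, B ∈ S) ∧
      ∀ v w, beval v w A = true → beval v w (conj M) = true → beval v w (conj L) = true := by
  induction L with
  | nil => exact ⟨[], by simp, by simp [conj, beval, Formula.top]⟩
  | cons a l ih =>
    obtain ⟨M, hM, hv⟩ := ih (fun B hB => h B (List.mem_cons_of_mem _ hB))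
    rcases h a List.mem_cons_self with rfl | ha
    · refine ⟨M, hM, fun v w h1 h2 => ?_⟩
      simp [conj, beval, h1, hv v w h1 h2]
    · refine ⟨a :: M, ?_, fun v w h1 h2 => ?_⟩
      · intro B hB
        rcases List.mem_cons.1 hB with rfl | hB
        · exact ha
        · exact hM B hB
      · simp [conj, beval] at h2 ⊢
        exact ⟨h2.1, hv v w h1 h2.2⟩

theorem mcs_closed_s11 {S : Set Formula} (hS : MaxConsistent S) {L : List Formula} {A : Formula}
    (hne : L ≠ []) (hL : ∀ B ∈ L, B ∈ S) (h : PCL ((conj L).imp A)) : A ∈ S := by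
  by_contra hA
  obtain ⟨L', _, hL', hbot⟩ := hS.2 A hA
  obtain ⟨M, hM, hv⟩ := split_list S A L' hL'
  refine hS.1 ⟨L ++ M, by simp [hne], ?_, ?_⟩
  · intro B hB
    rcases List.mem_append.1 hB with hB | hB
    · exact hL B hB
    · exact hM B hB
  · refine pcl_mp2 ?_ h hbot
    intro v w
    have := hv v w
    simp only [beval, conj_append_taut]
    revert this
    generalize beval v w A = a
    generalize beval v w (conj L) = b
    generalize beval v w (conj M) = c
    generalize beval v w (conj L') = d
    revert a b c d
    decide

theorem mcs_mp {S : Set Formula} (hS : MaxConsistent S) {A B : Formula}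
    (h : PCL (A.imp B)) (hA : A ∈ S) : B ∈ S := by
  refine mcs_closed_s11 hS (L := [A]) (by simp) (by simpa using hA) (Deriv.mp (Deriv.taut ?_) h)
  intro v w
  simp only [beval, conj, Formula.top]
  generalize beval v w A = a
  generalize beval v w B = b
  revert a b
  decide

theorem mcs_and {S : Set Formula} (hS : MaxConsistent S) {A B : Formula}
    (hA : A ∈ S) (hB : B ∈ S) : A.and B ∈ S := by
  refine mcs_closed_s11 hS (L := [A, B]) (by simp) (by simp [hA, hB]) (Deriv.taut ?_)
  intro v w
  simp only [beval, conj, Formula.top]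
  generalize beval v w A = a
  generalize beval v w B = b
  revert a b
  decide

section
variable {X : Set Formula}

theorem c_thm (hX : MaxConsistent X) {A B F : Formula} (hF : F ∈ X)
    (h : PCL (A.cond B)) : A.cond B ∈ X := by
  refine mcs_mp hX (Deriv.mp (Deriv.taut ?_) h) hF
  intro v w
  simp only [beval]
  generalize beval v w F = a
  generalize w A B = b
  revert a b
  decide

theorem c_weak (hX : MaxConsistent X) {P Q R : Formula} (h : Tautology (Q.imp R))
    (hq : P.cond Q ∈ X) : P.cond R ∈ X := mcs_mp hX (Deriv.rck (Deriv.taut h)) hq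

theorem c_left (hX : MaxConsistent X) {P Q R : Formula} (h : Tautology (P.biimp Q))
    (hq : P.cond R ∈ X) : Q.cond R ∈ X := by
  refine mcs_mp hX (Deriv.mp (Deriv.taut ?_) (Deriv.rcea (C := R) (Deriv.taut h))) hq
  intro v w
  simp only [beval, biimp]
  generalize w P R = a
  generalize w Q R = b
  revert a b
  decide

theorem c_and (hX : MaxConsistent X) {P Q R : Formula} (h1 : P.cond Q ∈ X)
    (h2 : P.cond R ∈ X) : P.cond (Q.and R) ∈ X := mcs_mp hX Deriv.rAnd (mcs_and hX h1 h2)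

theorem c_cm (hX : MaxConsistent X) {P Q R : Formula} (h1 : P.cond Q ∈ X)
    (h2 : P.cond R ∈ X) : (P.and Q).cond R ∈ X := mcs_mp hX Deriv.cm (mcs_and hX h1 h2)

theorem c_or (hX : MaxConsistent X) {P Q R : Formula} (h1 : P.cond R ∈ X)
    (h2 : Q.cond R ∈ X) : (P.or Q).cond R ∈ X := mcs_mp hX Deriv.or (mcs_and hX h1 h2)

/-- If `Q` implies `P` then `Q > R` gives `P > (Q → R)`. -/
theorem c_shift (hX : MaxConsistent X) {P Q R : Formula} (hQP : Tautology (Q.imp P))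
    (h : Q.cond R ∈ X) : P.cond (Q.imp R) ∈ X := by
  have a1 : Q.cond (Q.imp R) ∈ X := by
    refine c_weak hX ?_ h
    intro v w
    simp only [beval]
    generalize beval v w Q = a
    generalize beval v w R = b
    revert a b
    decide
  have a2 : (P.and Q.neg).cond (Q.imp R) ∈ X := by
    refine c_weak hX (Q := P.and Q.neg) ?_ (c_thm hX h Deriv.id)
    intro v w
    simp only [beval, neg]
    generalize beval v w P = c
    generalize beval v w Q = a
    generalize beval v w R = b
    revert a b c
    decide
  refine c_left hX ?_ (c_or hX a1 a2)
  intro v w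
  have := hQP v w
  revert this
  simp only [beval, neg, biimp]
  generalize beval v w P = c
  generalize beval v w Q = a
  revert a c
  decide
end

/-- If A ≤_X B ≤_X C, X^A ⊆ Y and C ∈ Y, then X^B ⊆ Y. -/
theorem condCons_subset_of_cleq_chain (X Y : Set Formula)
    (hX : MaxConsistent X) (hY : MaxConsistent Y) (A B C : Formula)
    (h1 : cleq X A B) (h2 : cleq X B C) (h3 : condCons X A ⊆ Y) (h4 : C ∈ Y) :
    condCons X B ⊆ Y := by
  intro D hD
  have hD : B.cond D ∈ X := hD
  have h1 : (A.or B).cond A ∈ X := h1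
  have h2 : (B.or C).cond B ∈ X := h2
  obtain ⟨E, hE⟩ : ∃ E, E = A.or (B.or C) := ⟨_, rfl⟩
  have e1 : E.cond ((A.or B).imp A) ∈ X := by
    refine c_shift hX ?_ h1
    intro v w
    simp only [hE, beval]
    generalize beval v w A = a
    generalize beval v w B = b
    generalize beval v w C = c
    revert a b c
    decide
  have e2 : E.cond ((B.or C).imp B) ∈ X := by
    refine c_shift hX ?_ h2
    intro v w
    simp only [hE, beval]
    generalize beval v w A = a
    generalize beval v w B = b
    generalize beval v w C = c
    revert a b c
    decide
  have e3 : E.cond (B.imp D) ∈ X := by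
    refine c_shift hX ?_ hD
    intro v w
    simp only [hE, beval]
    generalize beval v w A = a
    generalize beval v w B = b
    generalize beval v w C = c
    revert a b c
    decide
  have e0 : E.cond E ∈ X := c_thm hX hD Deriv.id
  have e4 : E.cond A ∈ X := by
    refine c_weak hX ?_ (c_and hX e0 (c_and hX e1 e2))
    intro v w
    simp only [hE, beval]
    generalize beval v w A = a
    generalize beval v w B = b
    generalize beval v w C = c
    revert a b c
    decide
  have e5 : E.cond (C.imp D) ∈ X := by
    refine c_weak hX ?_ (c_and hX e2 e3)
    intro v w
    simp only [beval]
    generalize beval v w D = a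
    generalize beval v w B = b
    generalize beval v w C = c
    revert a b c
    decide
  have e6 : A.cond (C.imp D) ∈ X := by
    refine c_left hX ?_ (c_cm hX e4 e5)
    intro v w
    simp only [hE, beval, biimp]
    generalize beval v w A = a
    generalize beval v w B = b
    generalize beval v w C = c
    revert a b c
    decide
  have e7 : C.imp D ∈ Y := h3 e6
  refine mcs_mp hY (Deriv.taut ?_) (mcs_and hY e7 h4)
  intro v w
  simp only [beval]
  generalize beval v w D = a
  generalize beval v w C = c
  revert a c
  decide
end

section
/- Completeness of PCL with respect to neighbourhood semantics: for every formula F of conditional logic, if F is valid in the class of all neighbourhood models, then ⊢_PCL F. -/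
open Formula

namespace PCLProof

lemma beval_conj (v : ℕ → Bool) (w : Formula → Formula → Bool) (L : List Formula) :
    beval v w (conj L) = true ↔ ∀ B ∈ L, beval v w B = true := by
  induction L with
  | nil => simp [conj, Formula.top, beval]
  | cons A L ih => simp [conj, beval, ih]

/-- Derivability from a set of premises. -/
def Pr (S : Set Formula) (A : Formula) : Prop :=
  ∃ L : List Formula, (∀ B ∈ L, B ∈ S) ∧ PCL ((conj L).imp A)

/-- Tautological consequence of one or two theorems. -/
lemma t1 {A B : Formula} (h : ∀ v w, beval v w A = true → beval v w B = true)
    (hA : PCL A) : PCL B := by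
  refine Deriv.mp (Deriv.taut ?_) hA
  intro v w
  have := h v w
  simp only [beval]
  cases hh : beval v w A <;> simp_all

lemma t2 {A B C : Formula}
    (h : ∀ v w, beval v w A = true → beval v w B = true → beval v w C = true)
    (hA : PCL A) (hB : PCL B) : PCL C := by
  refine Deriv.mp (Deriv.mp (Deriv.taut ?_) hA) hB
  intro v w
  have := h v w
  simp only [beval]
  cases hh : beval v w A <;> cases hh : beval v w B <;> simp_all

lemma imp_eval (v : ℕ → Bool) (w : Formula → Formula → Bool) (A B : Formula) :
    beval v w (A.imp B) = true ↔ (beval v w A = true → beval v w B = true) := by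
  simp only [beval]
  cases beval v w A <;> simp

lemma Pr.of_mem {S : Set Formula} {A : Formula} (h : A ∈ S) : Pr S A :=
  ⟨[A], by simpa using h, Deriv.taut (by
    intro v w
    rw [imp_eval, beval_conj]
    intro h; exact h A (by simp))⟩

lemma Pr.of_pcl {S : Set Formula} {A : Formula} (h : PCL A) : Pr S A :=
  ⟨[], by simp, t1 (by intro v w h; rw [imp_eval]; intro _; exact h) h⟩

lemma Pr.mp {S : Set Formula} {A B : Formula} (h : Pr S (A.imp B)) (h' : Pr S A) : Pr S B := by
  obtain ⟨L, hL, d⟩ := h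
  obtain ⟨L', hL', d'⟩ := h'
  refine ⟨L ++ L', ?_, t2 ?_ d d'⟩
  · intro B hB
    rcases List.mem_append.1 hB with h | h
    · exact hL _ h
    · exact hL' _ h
  · intro v w h1 h2
    simp only [imp_eval, beval_conj] at *
    intro h3
    exact h1 (fun B hB => h3 B (List.mem_append_left _ hB))
      (h2 (fun B hB => h3 B (List.mem_append_right _ hB)))

lemma Pr.ded {S : Set Formula} {A B : Formula} (h : Pr (insert A S) B) : Pr S (A.imp B) := by
  classical
  obtain ⟨L, hL, d⟩ := h
  refine ⟨L.filter (fun C => decide (C ≠ A)), ?_, t1 ?_ d⟩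
  · intro C hC
    have hC' := List.mem_filter.1 hC
    rcases hL C hC'.1 with h | h
    · simp [h] at hC'
    · exact h
  · intro v w h1
    simp only [imp_eval, beval_conj] at *
    intro h2 h3
    apply h1
    intro C hC
    by_cases e : C = A
    · rw [e]; exact h3
    · exact h2 C (List.mem_filter.2 ⟨hC, by simpa using e⟩)

/-- Maximal sets not deriving falsum. -/
def MC (S : Set Formula) : Prop := Maximal (fun T => ¬ Pr T Formula.bot) S

lemma lind {S : Set Formula} (hS : ¬ Pr S Formula.bot) : ∃ T, S ⊆ T ∧ MC T := by
  have key : ∀ c ⊆ {T | ¬ Pr T Formula.bot}, IsChain (· ⊆ ·) c → c.Nonempty →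
      ∃ ub ∈ {T | ¬ Pr T Formula.bot}, ∀ s ∈ c, s ⊆ ub := by
    intro c hc hch hne
    refine ⟨⋃₀ c, ?_, fun s hs => Set.subset_sUnion_of_mem hs⟩
    rintro ⟨L, hL, d⟩
    have : ∃ T ∈ c, ∀ B ∈ L, B ∈ T := by
      clear d
      induction L with
      | nil => obtain ⟨T, hT⟩ := hne; exact ⟨T, hT, by simp⟩
      | cons A L ih =>
        obtain ⟨T, hT, h1⟩ := ih (fun B hB => hL B (List.mem_cons_of_mem _ hB))
        obtain ⟨T', hT', h2⟩ := hL A (by simp)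
        rcases hch.total hT hT' with h | h
        · refine ⟨T', hT', ?_⟩
          intro B hB
          rcases List.mem_cons.1 hB with e | e
          · rw [e]; exact h2
          · exact h (h1 B e)
        · refine ⟨T, hT, ?_⟩
          intro B hB
          rcases List.mem_cons.1 hB with e | e
          · rw [e]; exact h h2
          · exact h1 B e
    obtain ⟨T, hT, h⟩ := this
    exact hc hT ⟨L, h, d⟩
  obtain ⟨T, hT, hm⟩ := zorn_subset_nonempty {T | ¬ Pr T Formula.bot} key S hS
  exact ⟨T, hT, hm⟩

lemma MC.closed {S : Set Formula} (hS : MC S) {A : Formula} (h : Pr S A) : A ∈ S := by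
  by_contra hA
  have : ¬ Pr (insert A S) Formula.bot := fun hh => hS.prop (hh.ded.mp h)
  exact hA (hS.le_of_ge this (Set.subset_insert A S) (Set.mem_insert A S))

lemma MC.bot {S : Set Formula} (hS : MC S) : Formula.bot ∉ S :=
  fun h => hS.prop (Pr.of_mem h)

lemma MC.pcl {S : Set Formula} (hS : MC S) {A : Formula} (h : PCL A) : A ∈ S :=
  hS.closed (Pr.of_pcl h)

lemma MC.mp {S : Set Formula} (hS : MC S) {A B : Formula} (h : A.imp B ∈ S) (h' : A ∈ S) :
    B ∈ S := hS.closed ((Pr.of_mem h).mp (Pr.of_mem h'))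

lemma MC.mp' {S : Set Formula} (hS : MC S) {A B : Formula} (h : PCL (A.imp B)) (h' : A ∈ S) :
    B ∈ S := hS.mp (hS.pcl h) h'

lemma MC.taut {S : Set Formula} (hS : MC S) {A B : Formula}
    (h : ∀ v w, beval v w A = true → beval v w B = true) (h' : A ∈ S) : B ∈ S :=
  hS.mp' (Deriv.taut (fun v w => (imp_eval v w A B).2 (h v w))) h'

lemma MC.imp {S : Set Formula} (hS : MC S) {A B : Formula} :
    A.imp B ∈ S ↔ (A ∈ S → B ∈ S) := by
  refine ⟨fun h => hS.mp h, fun h => ?_⟩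
  by_cases hA : A ∈ S
  · exact hS.taut (by intro v w; simp only [imp_eval]; tauto) (h hA)
  · by_contra hn
    have : Pr (insert A S) Formula.bot := by
      by_contra hh
      exact hA (hS.le_of_ge hh (Set.subset_insert A S) (Set.mem_insert A S))
    have h2 := hS.closed this.ded
    exact hn (hS.taut (by intro v w; simp only [beval]; cases beval v w A <;> simp) h2)

lemma MC.and {S : Set Formula} (hS : MC S) {A B : Formula} :
    A.and B ∈ S ↔ (A ∈ S ∧ B ∈ S) := by
  refine ⟨fun h => ⟨hS.taut ?_ h, hS.taut ?_ h⟩, fun h => hS.mp (hS.taut ?_ h.1) h.2⟩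
  · intro v w; simp [beval]; tauto
  · intro v w; simp [beval]
  · intro v w; simp only [imp_eval]; simp [beval]; tauto

lemma MC.or {S : Set Formula} (hS : MC S) {A B : Formula} :
    A.or B ∈ S ↔ (A ∈ S ∨ B ∈ S) := by
  constructor
  · intro h
    by_contra hn
    push Not at hn
    have h1 : A.imp Formula.bot ∈ S := hS.imp.2 (fun h => absurd h hn.1)
    exact hn.2 (hS.mp (hS.taut (A := A.or B) (B := (A.imp Formula.bot).imp B) (by
      intro v w; simp only [imp_eval]; simp [beval]
      cases beval v w A <;> simp) h) h1)
  · rintro (h | h)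
    · exact hS.taut (by intro v w; simp [beval]; tauto) h
    · exact hS.taut (by intro v w; simp [beval]; tauto) h

/-! Conditional reasoning inside a maximal set. -/

section
variable {X : Set Formula} (hX : MC X)

lemma cw (hX : MC X) {A B C : Formula} (h : ∀ v w, beval v w B = true → beval v w C = true)
    (h' : A.cond B ∈ X) : A.cond C ∈ X :=
  hX.mp' (Deriv.rck (Deriv.taut (fun v w => (imp_eval v w B C).2 (h v w)))) h'

lemma cw2 (hX : MC X) {A B C D : Formula}
    (h : ∀ v w, beval v w B = true → beval v w C = true → beval v w D = true)
    (h1 : A.cond B ∈ X) (h2 : A.cond C ∈ X) : A.cond D ∈ X :=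
  cw hX (B := B.and C) (by
    intro v w hh
    simp only [beval, Bool.and_eq_true] at hh
    exact h v w hh.1 hh.2) (hX.mp' Deriv.rAnd (hX.and.2 ⟨h1, h2⟩))

lemma ceq (hX : MC X) {A B C : Formula} (h : ∀ v w, beval v w A = beval v w B)
    (h' : A.cond C ∈ X) : B.cond C ∈ X := by
  have : PCL ((A.cond C).biimp (B.cond C)) := Deriv.rcea (Deriv.taut (by
    intro v w
    simp only [Formula.biimp, beval, h v w]
    cases beval v w B <;> rfl))
  exact hX.mp ((hX.and.1 (hX.pcl this)).1) h'

/-- Cautious monotonicity up to equivalence of antecedents. -/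
lemma ccm (hX : MC X) {A B C D : Formula}
    (h : ∀ v w, (beval v w A && beval v w B) = beval v w D)
    (h1 : A.cond B ∈ X) (h2 : A.cond C ∈ X) : D.cond C ∈ X :=
  ceq hX (A := A.and B) (by intro v w; simpa only [beval] using h v w)
    (hX.mp' Deriv.cm (hX.and.2 ⟨h1, h2⟩))

/-- If the antecedent is weakened only by worlds at which the consequent holds. -/
lemma cor (hX : MC X) {A B D : Formula} (h : A.cond B ∈ X)
    (h1 : ∀ v w, beval v w A = true → beval v w D = true)
    (h2 : ∀ v w, beval v w D = true → beval v w A = true ∨ beval v w B = true) :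
    D.cond B ∈ X := by
  have e : (D.and B).cond B ∈ X := cw hX (B := D.and B)
    (by intro v w; simp [beval]) (hX.pcl Deriv.id)
  refine ceq hX (A := A.or (D.and B)) ?_ (hX.mp' Deriv.or (hX.and.2 ⟨h, e⟩))
  intro v w
  have i1 := h1 v w
  have i2 := h2 v w
  clear h1 h2
  simp only [beval]
  revert i1 i2
  cases beval v w A <;> cases beval v w B <;> cases beval v w D <;> simp

lemma cpr (hX : MC X) {C A : Formula} (h : Pr (condCons X C) A) : C.cond A ∈ X := by
  obtain ⟨L, hL, d⟩ := h
  have : C.cond (conj L) ∈ X := by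
    clear d
    induction L with
    | nil =>
      exact cw hX (B := C) (by intro v w; simp [conj, Formula.top, beval])
        (hX.pcl Deriv.id)
    | cons B L ih =>
      exact hX.mp' Deriv.rAnd (hX.and.2 ⟨hL B (by simp),
        ih (fun B hB => hL B (List.mem_cons_of_mem _ hB))⟩)
  exact hX.mp' (Deriv.rck d) this

lemma avoid {S : Set Formula} {A : Formula} (h : ¬ Pr S A) : ∃ T, S ⊆ T ∧ MC T ∧ A ∉ T := by
  obtain ⟨T, hT, hm⟩ := lind (S := insert (A.imp Formula.bot) S) (by
    intro hh
    refine h ((Pr.of_pcl (Deriv.taut ?_)).mp hh.ded)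
    intro v w
    simp only [imp_eval]
    simp only [beval]
    cases beval v w A <;> simp)
  refine ⟨T, fun x hx => hT (Set.mem_insert_of_mem _ hx), hm, fun hA => ?_⟩
  exact hm.bot (hm.mp (hT (Set.mem_insert _ _)) hA)

end

/-- Worlds. -/
def World : Type := {p : Set Formula × Formula // MC p.1 ∧ p.2 ∈ p.1}

def sph (X : Set Formula) (Y : World) : Set World :=
  {Z | condCons X Z.val.2 ⊆ Z.val.1 ∧ cleq X Z.val.2 Y.val.2 ∧ Y.val.2 ∉ Z.val.1} ∪ {Y}

def cN (x : World) : Set (Set World) :=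
  {α | ∃ Y : World, condCons x.val.1 Y.val.2 ⊆ Y.val.1 ∧ α = sph x.val.1 Y}

def cVal (p : ℕ) : Set World := {w | Formula.atom p ∈ w.val.1}

/-- Existence of a world normal for `C` and avoiding `A`. -/
lemma exists_world {X : Set Formula} (hX : MC X) {C A : Formula} (h : C.cond A ∉ X) :
    ∃ Y : World, Y.val.2 = C ∧ condCons X C ⊆ Y.val.1 ∧ A ∉ Y.val.1 := by
  obtain ⟨T, hT, hm, hA⟩ := avoid (fun hh => h (cpr hX hh))
  exact ⟨⟨(T, C), hm, hT (hX.pcl Deriv.id)⟩, rfl, hT, hA⟩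

lemma cond_forward {X : Set Formula} (hX : MC X) {A B : Formula} (h : A.cond B ∈ X)
    (Y : World) (hY : condCons X Y.val.2 ⊆ Y.val.1) (hA : ∃ Z ∈ sph X Y, A ∈ Z.val.1) :
    ∃ V : World, condCons X V.val.2 ⊆ V.val.1 ∧ sph X V ⊆ sph X Y ∧
      (∃ Z ∈ sph X V, A ∈ Z.val.1) ∧ ∀ Z ∈ sph X V, A ∈ Z.val.1 → B ∈ Z.val.1 := by
  set C := Y.val.2 with hC
  -- the disjunction makes the material implication a consequence
  have hAB : (A.or C).cond (A.imp B) ∈ X := by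
    refine cor hX (A := A) (cw hX (B := B) ?_ h) ?_ ?_
    · intro v w; simp only [imp_eval]; tauto
    · intro v w; simp only [beval]; intro h; simp [h]
    · intro v w; simp only [imp_eval]; tauto
  by_cases hc : (A.or C).cond (A.imp C) ∈ X
  · have hcc : (A.or C).cond C ∈ X := by
      refine cw2 hX (B := A.or C) (C := A.imp C) ?_ (hX.pcl Deriv.id) hc
      intro v w
      simp only [beval]
      cases beval v w A <;> simp
    have hCB : C.cond (A.imp B) ∈ X := by
      refine ccm hX ?_ hcc hAB
      intro v w
      simp only [beval]
      cases beval v w A <;> cases beval v w C <;> rfl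
    refine ⟨Y, hY, subset_rfl, hA, ?_⟩
    rintro ⟨⟨Z, D⟩, hZ, hDZ⟩ hm hAZ
    rcases hm with ⟨h1, h2, h3⟩ | h1
    · exfalso
      simp only [← hC] at h1 h2 h3 hAZ
      have e1 : ((A.or C).or D).cond (A.imp C) ∈ X := by
        refine cor hX hc ?_ ?_
        · intro v w; simp only [beval]; intro h; simp [h]
        · intro v w; simp only [beval]
          cases beval v w A <;> simp
      have e2 : ((A.or C).or D).cond (C.imp D) ∈ X := by
        refine cor hX (A := D.or C) (cw hX (B := D) ?_ h2) ?_ ?_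
        · intro v w; simp only [imp_eval]; tauto
        · intro v w; simp only [beval]
          cases beval v w A <;> cases beval v w C <;> cases beval v w D <;> simp
        · intro v w; simp only [beval]
          cases beval v w A <;> cases beval v w C <;> cases beval v w D <;> simp
      have e3 : ((A.or C).or D).cond D ∈ X := by
        refine cw2 hX (B := (A.or C).or D) (C := (A.imp C).and (C.imp D)) ?_
          (hX.pcl Deriv.id) (hX.mp' Deriv.rAnd (hX.and.2 ⟨e1, e2⟩))
        intro v w; simp only [beval]
        cases beval v w A <;> cases beval v w C <;> cases beval v w D <;> simp
      have e4 : D.cond (A.imp C) ∈ X := by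
        refine ccm hX ?_ e3 e1
        intro v w; simp only [beval]
        cases beval v w A <;> cases beval v w C <;> cases beval v w D <;> rfl
      exact h3 (hZ.mp (h1 e4) hAZ)
    · have h1 : (⟨⟨Z, D⟩, hZ, hDZ⟩ : World) = Y := h1
      rw [h1] at hAZ ⊢
      exact Y.prop.1.mp (hY hCB) hAZ
  · obtain ⟨V, hV2, hV, hn⟩ := exists_world hX hc
    have hVm := V.prop.1
    rw [hVm.imp] at hn
    push Not at hn
    refine ⟨V, by rw [hV2]; exact hV, ?_, ⟨V, Or.inr rfl, hn.1⟩, ?_⟩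
    · rintro Z (⟨h1, h2, h3⟩ | h1)
      · rw [hV2] at h2 h3
        refine Or.inl ⟨h1, ?_, fun h => h3 (Z.prop.1.or.2 (Or.inr h))⟩
        unfold cleq at h2 ⊢
        refine ccm hX (B := Z.val.2.or C) ?_ (cw hX ?_ h2) h2
        · intro v w; simp only [beval, ← hC]
          cases beval v w A <;> cases beval v w C <;> cases beval v w Z.val.2 <;> rfl
        · intro v w; simp only [beval]; intro h; simp [h]
      · have h1 : Z = V := h1
        rw [h1]
        refine Or.inl ⟨by rw [hV2]; exact hV, ?_, hn.2⟩
        unfold cleq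
        rw [hV2, ← hC]
        refine ceq hX (A := A.or C) ?_ (hX.pcl Deriv.id)
        intro v w; simp only [beval]
        cases beval v w A <;> cases beval v w C <;> rfl
    · rintro Z (⟨h1, h2, h3⟩ | h1) hAZ
      · rw [hV2] at h3
        exact absurd (Z.prop.1.or.2 (Or.inl hAZ)) h3
      · have h1 : Z = V := h1
        rw [h1]
        exact hVm.mp (hV hAB) hn.1

lemma truth (A : Formula) : ∀ x : World, Force cN cVal A x ↔ A ∈ x.val.1 := by
  induction A with
  | atom p => intro x; rfl
  | bot => intro x; exact ⟨fun h => h.elim, fun h => x.prop.1.bot h⟩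
  | and A B ihA ihB => intro x; simp only [Force, ihA, ihB, x.prop.1.and]
  | or A B ihA ihB => intro x; simp only [Force, ihA, ihB, x.prop.1.or]
  | imp A B ihA ihB => intro x; simp only [Force, ihA, ihB, x.prop.1.imp]
  | cond A B ihA ihB =>
    intro x
    have hX := x.prop.1
    simp only [Force, ihA, ihB]
    constructor
    · intro h
      by_contra hn
      obtain ⟨Y, hY2, hY, hB⟩ := exists_world hX hn
      have hAY : A ∈ Y.val.1 := hY2 ▸ Y.prop.2
      obtain ⟨β, -, hβ, ⟨y, hy, hAy⟩, hall⟩ :=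
        h (sph x.val.1 Y) ⟨Y, by rw [hY2]; exact hY, rfl⟩ ⟨Y, Or.inr rfl, hAY⟩
      rcases hβ hy with ⟨-, -, h3⟩ | h3
      · rw [hY2] at h3; exact h3 hAy
      · have h3 : y = Y := h3
        rw [h3] at hy
        exact hB (hall Y hy hAY)
    · rintro h α ⟨Y, hY, rfl⟩ hA
      obtain ⟨V, hV, h1, h2, h3⟩ := cond_forward hX h Y hY hA
      exact ⟨sph x.val.1 V, ⟨V, hV, rfl⟩, h1, h2, h3⟩

end PCLProof

/-- Completeness of PCL w.r.t. neighbourhood semantics. -/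
theorem pcl_completeness (F : Formula) (h : ValidAll F) : PCL F := by
  by_contra hF
  have h0 : ¬ PCLProof.Pr ∅ F := by
    rintro ⟨L, hL, d⟩
    have : L = [] := List.eq_nil_iff_forall_not_mem.2 (fun B hB => hL B hB)
    subst this
    exact hF (Deriv.mp d (Deriv.taut (by intro v w; simp [conj, Formula.top, beval])))
  obtain ⟨T, -, hm, hT⟩ := PCLProof.avoid h0
  have htop : Formula.top ∈ T :=
    hm.pcl (Deriv.taut (by intro v w; simp [Formula.top, beval]))
  let x : PCLProof.World := ⟨(T, Formula.top), hm, htop⟩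
  have := h ⟨PCLProof.World, ⟨x⟩, PCLProof.cN, PCLProof.cVal, by
    rintro x α ⟨Y, -, rfl⟩
    exact ⟨Y, Or.inr rfl⟩⟩ x
  exact hT ((PCLProof.truth F x).1 this)
end

section
/- Completeness of PT: for every formula F of conditional logic, if F is valid in the class of all totally reflexive neighbourhood models, then F is derivable in the Hilbert system 𝒜_PT obtained from 𝒜_PCL by adding the axiom schemas (N) ¬(⊤ > ⊥) and (T) A → ¬(A > ⊥). -/
open Formula

namespace PTProof

/-- Derivability from hypotheses. -/
inductive Prov (Ax Γ : Set Formula) : Formula → Prop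
  | thm {A} : Deriv Ax A → Prov Ax Γ A
  | hyp {A} : A ∈ Γ → Prov Ax Γ A
  | mp {A B} : Prov Ax Γ (A.imp B) → Prov Ax Γ A → Prov Ax Γ B

variable {Ax : Set Formula}

theorem Prov.mono {Γ Δ : Set Formula} (h : Γ ⊆ Δ) {A : Formula} (hA : Prov Ax Γ A) :
    Prov Ax Δ A := by
  induction hA with
  | thm h => exact .thm h
  | hyp hm => exact .hyp (h hm)
  | mp _ _ i j => exact .mp i j

theorem Prov.ded {Γ : Set Formula} {A B : Formula} (h : Prov Ax (insert A Γ) B) :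
    Prov Ax Γ (A.imp B) := by
  induction h with
  | @thm C h =>
    refine .mp (.thm (.taut ?_)) (.thm h)
    intro v w
    simp only [beval]
    grind
  | @hyp C h =>
    rcases h with rfl | h
    · refine .thm (.taut ?_)
      intro v w
      simp only [beval]
      grind
    · refine .mp (.thm (.taut ?_)) (.hyp h)
      intro v w
      simp only [beval]
      grind
  | @mp C D _ _ i j =>
    refine .mp (.mp (.thm (.taut ?_)) i) j
    intro v w
    simp only [beval]
    grind

theorem Prov.empty {A : Formula} (h : Prov Ax ∅ A) : Deriv Ax A := by
  induction h with
  | thm h => exact h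
  | hyp h => exact absurd h (Set.notMem_empty _)
  | mp _ _ i j => exact .mp i j

theorem Prov.chain {c : Set (Set Formula)} (hc : IsChain (· ⊆ ·) c) (hne : c.Nonempty)
    {A : Formula} (h : Prov Ax (⋃₀ c) A) : ∃ Γ ∈ c, Prov Ax Γ A := by
  induction h with
  | thm h => exact ⟨_, hne.some_mem, .thm h⟩
  | hyp h =>
    obtain ⟨Γ, h1, h2⟩ := h
    exact ⟨Γ, h1, .hyp h2⟩
  | mp _ _ i j =>
    obtain ⟨Γ, h1, h2⟩ := i
    obtain ⟨Δ, h3, h4⟩ := j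
    rcases hc.total h1 h3 with h | h
    · exact ⟨Δ, h3, .mp (h2.mono h) h4⟩
    · exact ⟨Γ, h1, .mp h2 (h4.mono h)⟩

/-- Maximal consistent sets relative to `Ax`. -/
structure MCS (Ax X : Set Formula) : Prop where
  closed : ∀ {A}, Prov Ax X A → A ∈ X
  nbot : Formula.bot ∉ X
  imp_mem : ∀ {A B}, (A ∈ X → B ∈ X) → A.imp B ∈ X

theorem lindenbaum {Γ : Set Formula} {A : Formula} (h : ¬ Prov Ax Γ A) :
    ∃ X, MCS Ax X ∧ Γ ⊆ X ∧ A ∉ X := by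
  obtain ⟨X, hX, hmax⟩ := zorn_subset_nonempty {Δ | ¬ Prov Ax Δ A}
    (by
      intro c hc hch hne
      refine ⟨⋃₀ c, ?_, fun s hs => Set.subset_sUnion_of_mem hs⟩
      intro hp
      obtain ⟨Δ, h1, h2⟩ := Prov.chain hch hne hp
      exact hc h1 h2) Γ h
  have hnp : ¬ Prov Ax X A := hmax.prop
  have key : ∀ B, B ∉ X → Prov Ax X (B.imp A) := by
    intro B hB
    by_contra hn
    have h1 : ¬ Prov Ax (insert B X) A := fun h => hn h.ded
    exact hB (hmax.le_of_ge h1 (Set.subset_insert B X) (Set.mem_insert B X))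
  have closed : ∀ {B}, Prov Ax X B → B ∈ X := by
    intro B hB
    by_contra hn
    exact hnp (.mp (key B hn) hB)
  refine ⟨X, ⟨closed, ?_, ?_⟩, hX, fun h => hnp (.hyp h)⟩
  · intro hb
    refine hnp (.mp (.thm (.taut ?_)) (.hyp hb))
    intro v w
    simp only [beval]
    grind
  · intro B C hBC
    by_cases hB : B ∈ X
    · refine closed (.mp (.thm (.taut ?_)) (.hyp (hBC hB)))
      intro v w
      simp only [beval]
      grind
    · by_contra hn
      refine hnp (.mp (.mp (.thm (.taut ?_)) (key _ hB)) (key _ hn))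
      intro v w
      simp only [beval]
      grind

namespace MCS

variable {X : Set Formula}

theorem mp (hX : MCS Ax X) {A B : Formula} (h : Deriv Ax (A.imp B)) (hA : A ∈ X) : B ∈ X :=
  hX.closed (.mp (.thm h) (.hyp hA))

theorem imp_iff (hX : MCS Ax X) {A B : Formula} : A.imp B ∈ X ↔ (A ∈ X → B ∈ X) :=
  ⟨fun h hA => hX.closed (.mp (.hyp h) (.hyp hA)), hX.imp_mem⟩

theorem and_iff (hX : MCS Ax X) {A B : Formula} : A.and B ∈ X ↔ (A ∈ X ∧ B ∈ X) := by
  refine ⟨fun h => ⟨hX.mp (.taut ?_) h, hX.mp (.taut ?_) h⟩,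
    fun h => hX.closed (.mp (.mp (.thm (.taut ?_)) (.hyp h.1)) (.hyp h.2))⟩ <;>
  · intro v w
    simp only [beval]
    grind

theorem or_iff (hX : MCS Ax X) {A B : Formula} : A.or B ∈ X ↔ (A ∈ X ∨ B ∈ X) := by
  constructor
  · intro h
    by_contra! hn
    have h1 : A.imp Formula.bot ∈ X := hX.imp_mem fun h => absurd h hn.1
    have h2 : B.imp Formula.bot ∈ X := hX.imp_mem fun h => absurd h hn.2
    refine hX.nbot (hX.closed (.mp (.mp (.mp (.thm (.taut ?_)) (.hyp h)) (.hyp h1)) (.hyp h2)))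
    intro v w
    simp only [beval]
    grind
  · rintro (h | h) <;>
    · refine hX.mp (.taut ?_) h
      intro v w
      simp only [beval]
      grind

theorem rw_right (hX : MCS Ax X) {A B C : Formula} (h : A.cond B ∈ X)
    (t : Tautology (B.imp C)) : A.cond C ∈ X :=
  hX.mp (.rck (.taut t)) h

theorem rw_left (hX : MCS Ax X) {A B C : Formula} (h : A.cond C ∈ X)
    (t : Tautology (A.biimp B)) : B.cond C ∈ X :=
  (hX.imp_iff.1 (hX.and_iff.1 (hX.closed (.thm (.rcea (.taut t))))).1) h

theorem id (hX : MCS Ax X) {A : Formula} : A.cond A ∈ X := hX.closed (.thm .id)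

theorem rand (hX : MCS Ax X) {A B C : Formula} (h : A.cond B ∈ X) (h' : A.cond C ∈ X) :
    A.cond (B.and C) ∈ X :=
  hX.mp .rAnd (hX.and_iff.2 ⟨h, h'⟩)

theorem cm (hX : MCS Ax X) {A B C : Formula} (h : A.cond B ∈ X) (h' : A.cond C ∈ X) :
    (A.and B).cond C ∈ X :=
  hX.mp .cm (hX.and_iff.2 ⟨h, h'⟩)

theorem or (hX : MCS Ax X) {A B C : Formula} (h : A.cond C ∈ X) (h' : B.cond C ∈ X) :
    (A.or B).cond C ∈ X :=
  hX.mp .or (hX.and_iff.2 ⟨h, h'⟩)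

theorem of_prov (hX : MCS Ax X) {A B : Formula} (h : Prov Ax (condCons X A) B) :
    A.cond B ∈ X := by
  induction h with
  | @thm B h =>
    refine hX.mp (.rck (.mp (.taut ?_) h)) hX.id
    intro v w
    simp only [beval]
    grind
  | hyp h => exact h
  | mp _ _ i j =>
    refine hX.rw_right (hX.rand i j) ?_
    intro v w
    simp only [beval]
    grind

/-- Existence of a selected world refuting `B`. -/
theorem exists_of_not (hX : MCS Ax X) {A B : Formula} (h : A.cond B ∉ X) :
    ∃ Y, MCS Ax Y ∧ condCons X A ⊆ Y ∧ B ∉ Y :=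
  lindenbaum fun hp => h (hX.of_prov hp)

/-- From `A > B` infer `G > (A → B)` whenever `A` entails `G`. -/
theorem weaken (hX : MCS Ax X) {A B G : Formula} (h : A.cond B ∈ X) (t : Tautology (A.imp G)) :
    G.cond (A.imp B) ∈ X := by
  have h1 : A.cond (A.imp B) ∈ X := by
    refine hX.rw_right h ?_
    intro v w
    simp only [beval]
    grind
  have h2 : (G.and (A.imp Formula.bot)).cond (A.imp B) ∈ X := by
    refine hX.rw_right hX.id ?_
    intro v w
    simp only [beval]
    grind
  refine hX.rw_left (hX.or h1 h2) ?_
  intro v w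
  have := t v w
  simp only [beval, biimp] at this ⊢
  grind

/-- If `G > E` and `G > B` and `E` entails `G` then `E > B`. -/
theorem restrict (hX : MCS Ax X) {G E B : Formula} (h : G.cond E ∈ X) (h' : G.cond B ∈ X)
    (t : Tautology (E.imp G)) : E.cond B ∈ X := by
  refine hX.rw_left (hX.cm h h') ?_
  intro v w
  have := t v w
  simp only [beval, biimp] at this ⊢
  grind

theorem cleq_all (hX : MCS Ax X) {E F C : Formula} (h1 : cleq X E F) (h2 : cleq X F C) :
    (E.or (F.or C)).cond E ∈ X := by
  have a : (E.or (F.or C)).cond ((E.or F).imp E) ∈ X := by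
    refine hX.weaken h1 ?_
    intro v w
    simp only [beval]
    grind
  have b : (E.or (F.or C)).cond ((F.or C).imp F) ∈ X := by
    refine hX.weaken h2 ?_
    intro v w
    simp only [beval]
    grind
  refine hX.rw_right (hX.rand hX.id (hX.rand a b)) ?_
  intro v w
  simp only [beval]
  grind

theorem cleq_trans (hX : MCS Ax X) {E F C : Formula} (h1 : cleq X E F) (h2 : cleq X F C) :
    cleq X E C := by
  have h := hX.cleq_all h1 h2
  have h' : (E.or (F.or C)).cond (E.or C) ∈ X := by
    refine hX.rw_right h ?_
    intro v w
    simp only [beval]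
    grind
  refine hX.restrict h' h ?_
  intro v w
  simp only [beval]
  grind

theorem cleq_imp (hX : MCS Ax X) {E F C : Formula} (h1 : cleq X E F) (h2 : cleq X F C) :
    E.cond (C.imp F) ∈ X := by
  have b : (E.or (F.or C)).cond ((F.or C).imp F) ∈ X := by
    refine hX.weaken h2 ?_
    intro v w
    simp only [beval]
    grind
  have b' : (E.or (F.or C)).cond (C.imp F) ∈ X := by
    refine hX.rw_right b ?_
    intro v w
    simp only [beval]
    grind
  refine hX.restrict (hX.cleq_all h1 h2) b' ?_
  intro v w
  simp only [beval]
  grind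

theorem cleq_orr (hX : MCS Ax X) {A D : Formula} : cleq X (A.or D) D := by
  refine hX.rw_right hX.id ?_
  intro v w
  simp only [beval]
  grind

end MCS

/-- Canonical worlds. -/
def World (Ax : Set Formula) : Type := {X : Set Formula // MCS Ax X} × Formula

/-- Selected worlds. -/
def Sel (X : Set Formula) (Z : World Ax) : Prop := condCons X Z.2 ⊆ Z.1.1

/-- Canonical spheres. -/
def sph (X : Set Formula) (Y : World Ax) : Set (World Ax) :=
  {Z | Z = Y ∨ (Sel X Z ∧ cleq X Z.2 Y.2 ∧ Y.2 ∉ Z.1.1)}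

/-- Canonical neighbourhoods: the spheres, and one set containing everything relevant. -/
def nb (x : World Ax) : Set (Set (World Ax)) :=
  {α | α = {Z | Z = x ∨ Sel x.1.1 Z} ∨ ∃ Y, Sel x.1.1 Y ∧ α = sph x.1.1 Y}

/-- Canonical valuation. -/
def vl (p : ℕ) : Set (World Ax) := {w | Formula.atom p ∈ w.1.1}

theorem main_cond (x : World Ax) (hT : axT ⊆ Ax) {A B : Formula} :
    A.cond B ∈ x.1.1 ↔ ∀ α ∈ nb x, (∃ y ∈ α, A ∈ y.1.1) →
      ∃ β ∈ nb x, β ⊆ α ∧ (∃ y ∈ β, A ∈ y.1.1) ∧ ∀ y ∈ β, (A ∈ y.1.1 → B ∈ y.1.1) := by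
  obtain ⟨⟨X, hX⟩, L⟩ := x
  constructor
  · rintro hAB α (rfl | ⟨⟨⟨Y, hY⟩, C⟩, hYC, rfl⟩) ⟨⟨⟨Z, hZ⟩, D⟩, hZα, hAZ⟩
    · -- the big neighbourhood
      have hb : A.cond Formula.bot ∉ X := by
        intro hb
        rcases hZα with h | h
        · obtain ⟨h1, -⟩ := Prod.mk.injEq .. ▸ h
          obtain rfl : Z = X := congrArg Subtype.val h1
          have := hZ.mp (.extra (hT ⟨A, rfl⟩)) hAZ
          exact hZ.nbot (hZ.imp_iff.1 this hb)
        · have h1 : (A.or D).cond D ∈ X := by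
            refine hX.or (hX.rw_right hb ?_) hX.id
            intro v w
            simp only [beval]
            grind
          have h2 : (A.or D).cond (A.imp Formula.bot) ∈ X := by
            refine hX.weaken hb ?_
            intro v w
            simp only [beval]
            grind
          have h3 : D.cond (A.imp Formula.bot) ∈ X := by
            refine hX.restrict h1 h2 ?_
            intro v w
            simp only [beval]
            grind
          exact hZ.nbot (hZ.imp_iff.1 (h h3) hAZ)
      obtain ⟨V, hV, hs, -⟩ := hX.exists_of_not hb
      refine ⟨sph X (⟨V, hV⟩, A), Or.inr ⟨(⟨V, hV⟩, A), hs, rfl⟩, ?_, ⟨_, Or.inl rfl, hs hX.id⟩, ?_⟩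
      · rintro U (rfl | h)
        · exact Or.inr hs
        · exact Or.inr h.1
      · rintro U (rfl | h) hU
        · exact hs hAB
        · exact absurd hU h.2.2
    · have hw : ∀ D, (A.or D).cond (A.imp B) ∈ X := by
        intro D
        refine hX.weaken hAB ?_
        intro v w
        simp only [beval]
        grind
      have hYC' : condCons X C ⊆ Y := hYC
      -- the generic step: move to a world `(V, A ∨ D)` lacking `C`
      have step : ∀ D, cleq X D C → (A.or D).cond (A.imp C) ∉ X →
          ∃ β ∈ nb ((⟨X, hX⟩, L) : World Ax), β ⊆ sph X (⟨Y, hY⟩, C) ∧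
            (∃ y ∈ β, A ∈ y.1.1) ∧ ∀ y ∈ β, (A ∈ y.1.1 → B ∈ y.1.1) := by
        intro D hDC hn
        obtain ⟨V, hV, hs, hAC⟩ := hX.exists_of_not hn
        have hAV : A ∈ V := by
          by_contra h
          exact hAC (hV.imp_iff.2 fun h' => absurd h' h)
        have hCV : C ∉ V := fun h => hAC (hV.imp_iff.2 fun _ => h)
        have hFC : cleq X (A.or D) C := hX.cleq_trans hX.cleq_orr hDC
        refine ⟨sph X (⟨V, hV⟩, A.or D), Or.inr ⟨(⟨V, hV⟩, A.or D), hs, rfl⟩, ?_, ⟨_, Or.inl rfl, hAV⟩, ?_⟩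
        · rintro U (rfl | ⟨h1, h2, h3⟩)
          · exact Or.inr ⟨hs, hFC, hCV⟩
          · refine Or.inr ⟨h1, hX.cleq_trans h2 hFC, fun hC => h3 ?_⟩
            exact U.1.2.imp_iff.1 (h1 (hX.cleq_imp h2 hFC)) hC
        · rintro U (rfl | ⟨h1, h2, h3⟩) hU
          · exact hV.imp_iff.1 (hs (hw D)) hU
          · exact absurd (U.1.2.or_iff.2 (Or.inl hU)) h3
      rcases hZα with h | ⟨h1, h2, h3⟩
      · obtain ⟨h1, -⟩ := Prod.mk.injEq .. ▸ h
        obtain rfl : Z = Y := congrArg Subtype.val h1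
        by_cases hn : (A.or C).cond (A.imp C) ∈ X
        · have hCA' : (A.or C).cond C ∈ X := by
            refine hX.rw_right (hX.rand hX.id hn) ?_
            intro v w
            simp only [beval]
            grind
          have hCA : cleq X C A := by
            refine hX.rw_left hCA' ?_
            intro v w
            simp only [beval, biimp]
            grind
          refine ⟨_, Or.inr ⟨_, hYC, rfl⟩, subset_rfl, ⟨_, Or.inl rfl, hAZ⟩, ?_⟩
          rintro U (rfl | ⟨h1, h2, h3⟩) hU
          · have : C.cond (A.imp B) ∈ X := by
              refine hX.restrict hCA' (hw C) ?_
              intro v w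
              simp only [beval]
              grind
            exact hZ.imp_iff.1 (hYC' this) hU
          · exact absurd (U.1.2.imp_iff.1 (h1 (hX.cleq_imp h2 hCA)) hU) h3
        · refine step C ?_ hn
          refine hX.rw_right hX.id ?_
          intro v w
          simp only [beval]
          grind
      · refine step D h2 fun hn => h3 ?_
        have hD : D.cond (A.imp C) ∈ X := by
          have a : (A.or (D.or C)).cond ((A.or D).imp (A.imp C)) ∈ X := by
            refine hX.weaken hn ?_
            intro v w
            simp only [beval]
            grind
          have b : (A.or (D.or C)).cond ((D.or C).imp D) ∈ X := by
            refine hX.weaken h2 ?_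
            intro v w
            simp only [beval]
            grind
          have c := hX.rand hX.id (hX.rand a b)
          have d : (A.or (D.or C)).cond D ∈ X := by
            refine hX.rw_right c ?_
            intro v w
            simp only [beval]
            grind
          have e : (A.or (D.or C)).cond (A.imp C) ∈ X := by
            refine hX.rw_right c ?_
            intro v w
            simp only [beval]
            grind
          refine hX.restrict d e ?_
          intro v w
          simp only [beval]
          grind
        exact hZ.imp_iff.1 (h1 hD) hAZ
  · intro h
    by_contra hn
    obtain ⟨Y, hY, hs, hB⟩ := hX.exists_of_not hn
    have hA : A ∈ Y := hs hX.id
    obtain ⟨β, -, h1, ⟨y, hy, hAy⟩, h3⟩ := h (sph X (⟨Y, hY⟩, A)) (Or.inr ⟨(⟨Y, hY⟩, A), hs, rfl⟩)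
      ⟨_, Or.inl rfl, hA⟩
    rcases h1 hy with rfl | h'
    · exact hB (h3 _ hy hA)
    · exact h'.2.2 hAy

theorem truth (hT : axT ⊆ Ax) (A : Formula) :
    ∀ x : World Ax, Force nb vl A x ↔ A ∈ x.1.1 := by
  induction A with
  | atom p => exact fun x => Iff.rfl
  | bot => exact fun x => ⟨False.elim, x.1.2.nbot⟩
  | and A B i j => intro x; rw [x.1.2.and_iff, ← i, ← j]; rfl
  | or A B i j => intro x; rw [x.1.2.or_iff, ← i, ← j]; rfl
  | imp A B i j => intro x; rw [x.1.2.imp_iff, ← i, ← j]; rfl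
  | cond A B i j =>
    intro x
    rw [main_cond x hT]
    simp only [Force, i, j]

end PTProof

/-- Completeness of PT w.r.t. totally reflexive neighbourhood models. -/
theorem pt_completeness (F : Formula)
    (h : ∀ M : NbhdModel, M.TotallyReflexive → ∀ x : M.W, M.force F x) :
    Deriv (insert axN axT) F := by
  by_contra hn
  obtain ⟨X, hX, -, hF⟩ := PTProof.lindenbaum (Ax := insert axN axT) (Γ := ∅) (A := F)
    fun hp => hn hp.empty
  let x : PTProof.World (insert axN axT) := (⟨X, hX⟩, F)
  let M : NbhdModel :=
    { W := PTProof.World (insert axN axT)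
      wNonempty := ⟨x⟩
      N := PTProof.nb
      val := PTProof.vl
      nbhdNonempty := by
        rintro y α (rfl | ⟨Y, -, rfl⟩)
        · exact ⟨y, Or.inl rfl⟩
        · exact ⟨Y, Or.inl rfl⟩ }
  have hM : M.TotallyReflexive := fun y => ⟨_, Or.inl rfl, Or.inl rfl⟩
  exact hF ((PTProof.truth (Set.subset_insert _ _) F x).1 (h M hM x))
end
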